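/- Let n ≥ 1 and let c, d be real numbers with c ≠ d and (c,d) ≠ (0,1). (i) If c = 0, then P_{n−1}^⊥(T_1) ∩ P_{n−1}^⊥(K_{0,d}) is one-dimensional, spanned by the polynomial (x,y) ↦ P_n^{(1,3)}(1−2x). (ii) If d = 1, then P_{n−1}^⊥(T_1) ∩ P_{n−1}^⊥(K_{c,1}) is one-dimensional, spanned by (x,y) ↦ P_n^{(1,3)}(2(x+y)−1). (iii) If d = c+1, then P_{n−1}^⊥(T_1) ∩ P_{n−1}^⊥(K_{c,c+1}) is one-dimensional, spanned by (x,y) ↦ P_n^{(1,3)}(1−2y). -/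

import Mathlib

open MeasureTheory Finset

noncomputable section

/-- 2×2 determinant of two vectors in `ℝ²`. -/
def det2 (u v : ℝ × ℝ) : ℝ := u.1 * v.2 - u.2 * v.1

/-- The open triangle with vertices `A`, `B`, `C` (interior of the convex hull). -/
def tri (A B C : ℝ × ℝ) : Set (ℝ × ℝ) := interior (convexHull ℝ {A, B, C})

/-- Barycentric coordinate of `p` with respect to the vertex `A` of triangle `ABC`. -/
def bary (A B C p : ℝ × ℝ) : ℝ := det2 (p - B) (C - B) / det2 (A - B) (C - B)

/-- The cubic bubble: product of the three barycentric coordinates of triangle `ABC`. -/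
def bubble (A B C p : ℝ × ℝ) : ℝ := bary A B C p * bary B C A p * bary C A B p

/-- Evaluation of a bivariate polynomial at a point of `ℝ²`. -/
def evalP (u : MvPolynomial (Fin 2) ℝ) (p : ℝ × ℝ) : ℝ :=
  MvPolynomial.eval ![p.1, p.2] u

/-- The inner product `(u,v)_K := ∫_K u v ω_K` on the open triangle `K = conv°(A,B,C)`,
with weight the product of the barycentric coordinates. -/
def innerT (A B C : ℝ × ℝ) (u v : MvPolynomial (Fin 2) ℝ) : ℝ :=
  ∫ p in tri A B C, evalP u p * evalP v p * bubble A B C p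

/-- `u ∈ P_{n-1}^⊥(K)` for `K = conv°(A,B,C)`: `u` has total degree at most `n` and is
orthogonal to every polynomial of total degree at most `n-1` w.r.t. `(·,·)_K`. -/
def inPerp (n : ℕ) (A B C : ℝ × ℝ) (u : MvPolynomial (Fin 2) ℝ) : Prop :=
  u.totalDegree ≤ n ∧
    ∀ w : MvPolynomial (Fin 2) ℝ, w.totalDegree ≤ n - 1 → innerT A B C u w = 0

/-- Shifted factorial (Pochhammer symbol) `(a)_k = a (a+1) ⋯ (a+k-1)`. -/
def poch (a : ℝ) (k : ℕ) : ℝ := ∏ j ∈ Finset.range k, (a + j)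

/-- The Jacobi polynomial `P_n^{(a,b)}` as a univariate real polynomial,
`P_n^{(a,b)}(x) = ((a+1)_n/n!) Σ_{k=0}^n ((-n)_k (n+a+b+1)_k)/((a+1)_k k!) ((1-x)/2)^k`. -/
def jacobiPoly (n : ℕ) (a b : ℝ) : Polynomial ℝ :=
  Polynomial.C (poch (a + 1) n / (n.factorial : ℝ)) *
    ∑ k ∈ Finset.range (n + 1),
      Polynomial.C (poch (-(n : ℝ)) k * poch ((n : ℝ) + a + b + 1) k /
          (poch (a + 1) k * (k.factorial : ℝ))) *
        (Polynomial.C (2⁻¹ : ℝ) * (1 - Polynomial.X)) ^ k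

/-- The value `P_n^{(a,b)}(x)` of the Jacobi polynomial. -/
def jacobiR (n : ℕ) (a b x : ℝ) : ℝ := (jacobiPoly n a b).eval x

/-- Substitute a bivariate polynomial into a univariate polynomial. -/
def substX (f : Polynomial ℝ) (g : MvPolynomial (Fin 2) ℝ) : MvPolynomial (Fin 2) ℝ :=
  Polynomial.aeval g f

open scoped Polynomial

abbrev BiPoly := MvPolynomial (Fin 2) ℝ

/-- The open unit triangle `T₁`. -/
abbrev unitTri : Set (ℝ × ℝ) := tri (0, 0) (1, 0) (0, 1)

abbrev unitBubble (p : ℝ × ℝ) : ℝ := bubble (0, 0) (1, 0) (0, 1) p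

lemma unitBubble_apply (p : ℝ × ℝ) : unitBubble p = p.1 * p.2 * (1 - p.1 - p.2) := by
  simp only [bubble, bary, det2, Prod.fst_sub, Prod.snd_sub]
  ring

lemma convexHull_unitTri :
    convexHull ℝ {((0, 0) : ℝ × ℝ), (1, 0), (0, 1)} =
      {p : ℝ × ℝ | 0 ≤ p.1 ∧ 0 ≤ p.2 ∧ p.1 + p.2 ≤ 1} := by
  apply Set.Subset.antisymm
  · refine convexHull_min ?_ ?_
    · rintro p (rfl | rfl | rfl) <;> norm_num
    · rintro p ⟨h1, h2, h3⟩ q ⟨h4, h5, h6⟩ s t hs ht hst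
      simp only [Set.mem_ofPred_eq, Prod.fst_add, Prod.snd_add, Prod.smul_fst, Prod.smul_snd,
        smul_eq_mul]
      refine ⟨by positivity, by positivity, ?_⟩
      nlinarith [mul_le_mul_of_nonneg_left h3 hs, mul_le_mul_of_nonneg_left h6 ht]
  · rintro ⟨x, y⟩ ⟨h1, h2, h3⟩
    simp only at h1 h2 h3
    rw [convexHull_insert (by simp), convexHull_pair, convexJoin_singleton_left]
    simp only [Set.mem_iUnion]
    rcases (add_nonneg h1 h2).eq_or_lt with h | h
    · have hx : x = 0 := by linarith
      have hy : y = 0 := by linarith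
      subst hx hy
      exact ⟨(1, 0), left_mem_segment _ _ _, left_mem_segment _ _ _⟩
    · refine ⟨(x / (x + y), y / (x + y)), ⟨x / (x + y), y / (x + y), by positivity,
        by positivity, by field_simp, by simp⟩, ⟨1 - x - y, x + y, by linarith, h.le, by ring, ?_⟩⟩
      ext <;> simp <;> field_simp

lemma mem_unitTri {p : ℝ × ℝ} (h1 : 0 < p.1) (h2 : 0 < p.2) (h3 : p.1 + p.2 < 1) :
    p ∈ unitTri := by
  have ho : IsOpen {p : ℝ × ℝ | 0 < p.1 ∧ 0 < p.2 ∧ p.1 + p.2 < 1} :=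
    (isOpen_lt continuous_const continuous_fst).inter
      ((isOpen_lt continuous_const continuous_snd).inter
        (isOpen_lt (continuous_fst.add continuous_snd) continuous_const))
  refine interior_maximal ?_ ho ⟨h1, h2, h3⟩
  rw [convexHull_unitTri]
  rintro q ⟨h1, h2, h3⟩
  exact ⟨h1.le, h2.le, h3.le⟩

lemma unitTri_subset : unitTri ⊆ {p : ℝ × ℝ | 0 ≤ p.1 ∧ 0 ≤ p.2 ∧ p.1 + p.2 ≤ 1} := by
  rw [← convexHull_unitTri]
  exact interior_subset

lemma unitTri_ae_eq :
    unitTri =ᵐ[volume] {p : ℝ × ℝ | 0 ≤ p.1 ∧ 0 ≤ p.2 ∧ p.1 + p.2 ≤ 1} := by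
  rw [← convexHull_unitTri]
  exact interior_ae_eq_of_null_frontier ((convex_convexHull ℝ _).addHaar_frontier _)

lemma integrableOn_unitTri {f : ℝ × ℝ → ℝ} (hf : Continuous f) : IntegrableOn f unitTri := by
  refine IntegrableOn.mono_set
    ((hf.continuousOn).integrableOn_compact (K := Set.Icc (0 : ℝ × ℝ) 1) isCompact_Icc) ?_
  intro p hp
  obtain ⟨h1, h2, h3⟩ := unitTri_subset hp
  exact ⟨⟨h1, h2⟩, ⟨by simp only [Prod.fst_one]; linarith, by simp only [Prod.snd_one]; linarith⟩⟩

lemma continuous_evalP (u : BiPoly) : Continuous (evalP u) := by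
  refine (MvPolynomial.continuous_eval u).comp (continuous_pi fun i => ?_)
  fin_cases i
  · exact continuous_fst
  · exact continuous_snd

lemma continuous_unitBubble : Continuous unitBubble := by
  have : unitBubble = fun p => p.1 * p.2 * (1 - p.1 - p.2) := funext unitBubble_apply
  rw [this]
  fun_prop

/-- The integral of a polynomial against the bubble weight of the unit triangle. -/
def bubbleIntegral : BiPoly →ₗ[ℝ] ℝ where
  toFun u := ∫ p in unitTri, evalP u p * unitBubble p
  map_add' u v := by
    have h (w : BiPoly) : IntegrableOn (fun p => evalP w p * unitBubble p) unitTri :=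
      integrableOn_unitTri ((continuous_evalP w).mul continuous_unitBubble)
    rw [← integral_add (h u) (h v)]
    simp [evalP, add_mul]
  map_smul' t u := by
    simp [evalP, mul_assoc, integral_const_mul]

lemma innerT_unitTri (u v : BiPoly) :
    innerT (0, 0) (1, 0) (0, 1) u v = bubbleIntegral (u * v) := by
  simp [innerT, bubbleIntegral, evalP]

lemma eq_zero_of_bubbleIntegral_mul_self {u : BiPoly} (h : bubbleIntegral (u * u) = 0) :
    u = 0 := by
  have hc : Continuous fun p => evalP (u * u) p * unitBubble p :=
    (continuous_evalP _).mul continuous_unitBubble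
  have hm : MeasurableSet unitTri := isOpen_interior.measurableSet
  have hnn : ∀ p ∈ unitTri, 0 ≤ evalP (u * u) p * unitBubble p := by
    intro p hp
    obtain ⟨h1, h2, h3⟩ := unitTri_subset hp
    have h4 : 0 ≤ 1 - p.1 - p.2 := by linarith
    rw [unitBubble_apply, evalP, map_mul]
    exact mul_nonneg (mul_self_nonneg _) (by positivity)
  have hae := (setIntegral_eq_zero_iff_of_nonneg_ae
    ((ae_restrict_iff' hm).2 (.of_forall hnn)) (integrableOn_unitTri hc)).1 h
  have heq := Measure.eqOn_open_of_ae_eq hae isOpen_interior hc.continuousOn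
    continuous_const.continuousOn
  refine MvPolynomial.funext_set (fun _ => Set.Ioo (0 : ℝ) (1 / 2))
    (fun _ => Set.Ioo_infinite (by norm_num)) fun x hx => ?_
  have h0 := hx 0 trivial
  have h1 := hx 1 trivial
  have hp : 0 < 1 - x 0 - x 1 := by linarith [h0.2, h1.2]
  have hb : 0 < unitBubble (x 0, x 1) := by
    rw [unitBubble_apply]
    exact mul_pos (mul_pos h0.1 h1.1) hp
  have hz := heq (mem_unitTri (p := (x 0, x 1)) h0.1 h1.1 (by simpa using by linarith))
  have hx : ![x 0, x 1] = x := by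
    ext i
    fin_cases i <;> rfl
  simpa [evalP, hx, hb.ne'] using hz

/-- The moments `∫₀¹ xᵖ (1-x)ʳ dx`. -/
def betaMoment (p r : ℕ) : ℝ := ∫ x in (0 : ℝ)..1, x ^ p * (1 - x) ^ r

lemma betaMoment_succ_left (p r : ℕ) :
    (p + r + 2) * betaMoment (p + 1) r = (p + 1) * betaMoment p r := by
  have h : ∀ x ∈ Set.uIcc (0 : ℝ) 1, HasDerivAt (fun x : ℝ => x ^ (p + 1) * (1 - x) ^ (r + 1))
      ((p + 1) * (x ^ p * (1 - x) ^ r) - (p + r + 2) * (x ^ (p + 1) * (1 - x) ^ r)) x := by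
    intro x _
    have h1 := hasDerivAt_pow (p + 1) x
    have h2 := ((hasDerivAt_id x).const_sub 1).pow (r + 1)
    refine (h1.mul h2).congr_deriv ?_
    simp
    ring
  have := intervalIntegral.integral_eq_sub_of_hasDerivAt h
    (Continuous.intervalIntegrable (by fun_prop) _ _)
  rw [intervalIntegral.integral_sub (Continuous.intervalIntegrable (by fun_prop) _ _)
    (Continuous.intervalIntegrable (by fun_prop) _ _), intervalIntegral.integral_const_mul,
    intervalIntegral.integral_const_mul] at this
  simp only [betaMoment]
  simp at this
  linarith

lemma betaMoment_succ_right (p r : ℕ) :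
    (p + r + 2) * betaMoment p (r + 1) = (r + 1) * betaMoment p r := by
  have h : betaMoment p (r + 1) = betaMoment p r - betaMoment (p + 1) r := by
    simp only [betaMoment]
    rw [← intervalIntegral.integral_sub (Continuous.intervalIntegrable (by fun_prop) _ _)
      (Continuous.intervalIntegrable (by fun_prop) _ _)]
    congr 1
    ext x
    ring
  rw [h, mul_sub, betaMoment_succ_left]
  ring

lemma integral_pow_mul_sub (q : ℕ) (s : ℝ) :
    ∫ y in (0 : ℝ)..s, y ^ (q + 1) * (s - y) = s ^ (q + 3) / ((q + 2) * (q + 3)) := by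
  have h : ∀ y ∈ Set.uIcc (0 : ℝ) s, HasDerivAt
      (fun y : ℝ => s * y ^ (q + 2) / (q + 2) - y ^ (q + 3) / (q + 3)) (y ^ (q + 1) * (s - y)) y := by
    intro y _
    have h1 := ((hasDerivAt_pow (q + 2) y).const_mul s).div_const ((q : ℝ) + 2)
    have h2 := (hasDerivAt_pow (q + 3) y).div_const ((q : ℝ) + 3)
    refine (h1.sub h2).congr_deriv ?_
    push_cast
    field_simp
    ring
  rw [intervalIntegral.integral_eq_sub_of_hasDerivAt h
    (Continuous.intervalIntegrable (by fun_prop) _ _)]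
  field_simp
  ring

lemma integral_unitTri (f : ℝ × ℝ → ℝ) (hf : Continuous f) :
    ∫ p in unitTri, f p = ∫ x in (0 : ℝ)..1, ∫ y in (0 : ℝ)..(1 - x), f (x, y) := by
  have hm : MeasurableSet {p : ℝ × ℝ | 0 ≤ p.1 ∧ 0 ≤ p.2 ∧ p.1 + p.2 ≤ 1} :=
    ((isClosed_le continuous_const continuous_fst).inter
      ((isClosed_le continuous_const continuous_snd).inter
        (isClosed_le (continuous_fst.add continuous_snd) continuous_const))).measurableSet
  have hi := (integrableOn_unitTri hf).congr_set_ae unitTri_ae_eq.symm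
  rw [setIntegral_congr_set unitTri_ae_eq, ← integral_indicator hm,
    Measure.volume_eq_prod, integral_prod _ (by
      rw [← Measure.volume_eq_prod]; exact (integrable_indicator_iff hm).2 hi),
    intervalIntegral.integral_of_le zero_le_one, ← integral_Icc_eq_integral_Ioc,
    ← integral_indicator measurableSet_Icc]
  congr 1
  ext x
  by_cases hx : x ∈ Set.Icc (0 : ℝ) 1
  · rw [Set.indicator_of_mem hx, intervalIntegral.integral_of_le (by linarith [hx.2]),
      ← integral_Icc_eq_integral_Ioc, ← integral_indicator measurableSet_Icc]
    congr 1
    ext y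
    have : (0 ≤ x ∧ 0 ≤ y ∧ x + y ≤ 1) ↔ (0 ≤ y ∧ y ≤ 1 - x) :=
      ⟨fun h => ⟨h.2.1, by linarith⟩, fun h => ⟨hx.1, h.1, by linarith⟩⟩
    simp only [Set.indicator_apply, Set.mem_ofPred_eq, Set.mem_Icc, this]
  · rw [Set.indicator_of_notMem hx]
    refine integral_eq_zero_of_ae (.of_forall fun y => ?_)
    refine Set.indicator_of_notMem (fun h => hx ?_) _
    obtain ⟨h1, h2, h3⟩ := h
    simp only at h1 h2 h3
    exact ⟨h1, by linarith⟩

open MvPolynomial in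
lemma bubbleIntegral_X_pow_mul (i j : ℕ) :
    bubbleIntegral (X 0 ^ i * X 1 ^ j) = betaMoment (i + 1) (j + 3) / ((j + 2) * (j + 3)) := by
  have h : bubbleIntegral (X 0 ^ i * X 1 ^ j) =
      ∫ p in unitTri, p.1 ^ (i + 1) * (p.2 ^ (j + 1) * (1 - p.1 - p.2)) := by
    simp only [bubbleIntegral, LinearMap.coe_mk, AddHom.coe_mk]
    congr 1
    ext p
    rw [unitBubble_apply]
    simp [evalP]
    ring
  rw [h, integral_unitTri _ (by fun_prop), betaMoment, ← intervalIntegral.integral_div]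
  congr 1
  ext x
  simp only
  rw [intervalIntegral.integral_const_mul, integral_pow_mul_sub]
  ring

open MvPolynomial

lemma monomial_eq_smul (m : Fin 2 →₀ ℕ) (r : ℝ) :
    (monomial m r : BiPoly) = r • (X 0 ^ m 0 * X 1 ^ m 1) := by
  rw [monomial_eq, Finsupp.prod_fintype _ _ (by simp), Fin.prod_univ_two, smul_eq_C_mul]

lemma bubbleIntegral_div_zero (f : BiPoly) :
    bubbleIntegral (X 0 * (1 - X 0) * pderiv 0 f - X 0 * X 1 * pderiv 1 f
      + (2 - 6 * X 0) * f) = 0 := by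
  induction f using MvPolynomial.induction_on' with
  | monomial m r =>
    have h0 := X_mul_pderiv_monomial (i := 0) (m := m) (r := r)
    have h1 := X_mul_pderiv_monomial (i := 1) (m := m) (r := r)
    have h : X 0 * (1 - X 0) * pderiv 0 (monomial m r) - X 0 * X 1 * pderiv 1 (monomial m r)
        + (2 - 6 * X 0) * monomial m r = ((m 0 + 2 : ℝ) * r) • (X 0 ^ m 0 * X 1 ^ m 1 : BiPoly)
          - ((m 0 + m 1 + 6 : ℝ) * r) • (X 0 ^ (m 0 + 1) * X 1 ^ m 1 : BiPoly) := by
      rw [show X 0 * (1 - X 0) * pderiv 0 (monomial m r)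
        - X 0 * X 1 * pderiv 1 (monomial m r) + (2 - 6 * X 0) * monomial m r
        = (1 - X 0) * (X 0 * pderiv 0 (monomial m r)) - X 0 * (X 1 * pderiv 1 (monomial m r))
          + (2 - 6 * X 0) * monomial m r by ring, h0, h1, monomial_eq_smul]
      simp only [smul_eq_C_mul, nsmul_eq_mul, map_add, map_mul, map_natCast, map_ofNat]
      ring
    rw [h, map_sub, map_smul, map_smul, bubbleIntegral_X_pow_mul, bubbleIntegral_X_pow_mul]
    have hb := betaMoment_succ_left (m 0 + 1) (m 1 + 3)
    push_cast at hb
    simp only [smul_eq_mul]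
    field_simp
    linear_combination (-r) * hb
  | add p q hp hq =>
    simp only [map_add, map_sub, mul_add] at *
    linear_combination hp + hq

lemma bubbleIntegral_div_one (f : BiPoly) :
    bubbleIntegral (X 1 * (1 - X 1) * pderiv 1 f - X 0 * X 1 * pderiv 0 f
      + (2 - 6 * X 1) * f) = 0 := by
  induction f using MvPolynomial.induction_on' with
  | monomial m r =>
    have h0 := X_mul_pderiv_monomial (i := 0) (m := m) (r := r)
    have h1 := X_mul_pderiv_monomial (i := 1) (m := m) (r := r)
    have h : X 1 * (1 - X 1) * pderiv 1 (monomial m r) - X 0 * X 1 * pderiv 0 (monomial m r)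
        + (2 - 6 * X 1) * monomial m r = ((m 1 + 2 : ℝ) * r) • (X 0 ^ m 0 * X 1 ^ m 1 : BiPoly)
          - ((m 0 + m 1 + 6 : ℝ) * r) • (X 0 ^ m 0 * X 1 ^ (m 1 + 1) : BiPoly) := by
      rw [show X 1 * (1 - X 1) * pderiv 1 (monomial m r)
        - X 0 * X 1 * pderiv 0 (monomial m r) + (2 - 6 * X 1) * monomial m r
        = (1 - X 1) * (X 1 * pderiv 1 (monomial m r)) - X 1 * (X 0 * pderiv 0 (monomial m r))
          + (2 - 6 * X 1) * monomial m r by ring, h0, h1, monomial_eq_smul]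
      simp only [smul_eq_C_mul, nsmul_eq_mul, map_add, map_mul, map_natCast, map_ofNat]
      ring
    rw [h, map_sub, map_smul, map_smul, bubbleIntegral_X_pow_mul, bubbleIntegral_X_pow_mul]
    have hb := betaMoment_succ_right (m 0 + 1) (m 1 + 3)
    rw [add_right_comm (m 1)] at hb
    push_cast at hb
    simp only [smul_eq_mul]
    push_cast
    field_simp
    linear_combination (-(r * (m 1 + 3))) * hb
  | add p q hp hq =>
    simp only [map_add, map_sub, mul_add] at *
    linear_combination hp + hq

/-- Appell's operator of the unit triangle, whose eigenspaces are the spaces `P_{n-1}^⊥(T₁)`. -/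
def appell (u : BiPoly) : BiPoly :=
  X 0 * (1 - X 0) * pderiv 0 (pderiv 0 u) - 2 * (X 0 * X 1 * pderiv 0 (pderiv 1 u))
    + X 1 * (1 - X 1) * pderiv 1 (pderiv 1 u) + (2 - 6 * X 0) * pderiv 0 u
    + (2 - 6 * X 1) * pderiv 1 u

lemma pderiv_comm (u : BiPoly) : pderiv 1 (pderiv 0 u) = pderiv 0 (pderiv 1 u) := by
  ext m
  simp only [coeff_pderiv, add_right_comm m]
  simp
  ring

lemma bubbleIntegral_appell_mul (u w : BiPoly) :
    bubbleIntegral (appell u * w) = bubbleIntegral (u * appell w) := by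
  have key (u w : BiPoly) : bubbleIntegral (appell u * w) =
      -bubbleIntegral (X 0 * (1 - X 0) * pderiv 0 u * pderiv 0 w
        - X 0 * X 1 * (pderiv 0 u * pderiv 1 w + pderiv 1 u * pderiv 0 w)
        + X 1 * (1 - X 1) * pderiv 1 u * pderiv 1 w) := by
    have h0 := bubbleIntegral_div_zero (pderiv 0 u * w)
    have h1 := bubbleIntegral_div_one (pderiv 1 u * w)
    rw [eq_neg_iff_add_eq_zero, ← map_add, ← (congrArg₂ (· + ·) h0 h1).trans (add_zero 0)]
    simp only [← map_add]
    congr 1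
    simp only [pderiv_mul, appell, pderiv_comm]
    ring
  rw [mul_comm u, key, key]
  refine congrArg (fun f => -bubbleIntegral f) ?_
  ring

/-- `u` has total degree less than `k`. -/
def DegLT (k : ℕ) (u : BiPoly) : Prop := ∀ m : Fin 2 →₀ ℕ, k ≤ m 0 + m 1 → coeff m u = 0

lemma degree_eq_add (m : Fin 2 →₀ ℕ) : m.degree = m 0 + m 1 := by
  rw [Finsupp.degree_eq_sum, Fin.sum_univ_two]

lemma degLT_succ_iff {k : ℕ} {u : BiPoly} : DegLT (k + 1) u ↔ u.totalDegree ≤ k := by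
  refine ⟨fun h => ?_, fun h m hm => coeff_eq_zero_of_totalDegree_lt ?_⟩
  · refine Finset.sup_le fun m hm => ?_
    by_contra! hlt
    have : m.degree = m.sum fun _ e => e := rfl
    exact mem_support_iff.1 hm (h m (by rw [← degree_eq_add]; omega))
  · have : m.degree = ∑ i ∈ m.support, m i := rfl
    rw [← this, degree_eq_add]
    omega

lemma coeff_X_mul_pderiv (i : Fin 2) (u : BiPoly) (m : Fin 2 →₀ ℕ) :
    coeff m (X i * pderiv i u) = m i * coeff m u := by
  induction u using MvPolynomial.induction_on' with
  | monomial a r =>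
    rw [X_mul_pderiv_monomial, coeff_smul]
    by_cases h : a = m
    · simp [h]
    · simp [coeff_monomial, h]
  | add p q hp hq => simp only [map_add, mul_add, coeff_add, hp, hq]

lemma coeff_appell (u : BiPoly) (m : Fin 2 →₀ ℕ) :
    coeff m (appell u) =
      (m 0 + 1) * (m 0 + 2) * coeff (m + Finsupp.single 0 1) u
      + (m 1 + 1) * (m 1 + 2) * coeff (m + Finsupp.single 1 1) u
      - (m 0 + m 1) * (m 0 + m 1 + 5) * coeff m u := by
  have h : appell u = X 0 * pderiv 0 (pderiv 0 u) + (2 : ℝ) • pderiv 0 u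
      + X 1 * pderiv 1 (pderiv 1 u) + (2 : ℝ) • pderiv 1 u
      - X 0 * pderiv 0 (X 0 * pderiv 0 u + X 1 * pderiv 1 u)
      - X 1 * pderiv 1 (X 0 * pderiv 0 u + X 1 * pderiv 1 u)
      - (5 : ℝ) • (X 0 * pderiv 0 u) - (5 : ℝ) • (X 1 * pderiv 1 u) := by
    simp only [appell, map_add, pderiv_mul, pderiv_comm, pderiv_X_self, smul_eq_C_mul, map_ofNat,
      pderiv_X_of_ne (show (0 : Fin 2) ≠ 1 by decide),
      pderiv_X_of_ne (show (1 : Fin 2) ≠ 0 by decide)]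
    ring
  rw [h]
  simp only [coeff_sub, coeff_add, coeff_smul, coeff_X_mul_pderiv, coeff_pderiv, smul_eq_mul]
  ring

lemma DegLT.appell_add {k : ℕ} {u : BiPoly} (h : DegLT (k + 1) u) :
    DegLT k (appell u + (k * (k + 5) : ℝ) • u) := by
  intro m hm
  have h0 : coeff (m + Finsupp.single 0 1) u = 0 := h _ (by simp; omega)
  have h1 : coeff (m + Finsupp.single 1 1) u = 0 := h _ (by simp; omega)
  rw [coeff_add, coeff_smul, coeff_appell, h0, h1]
  rcases hm.eq_or_lt with hk | hk
  · rw [hk]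
    push_cast
    simp
  · simp [h m hk]

lemma bubbleIntegral_mul_eq_zero_of_appell {n : ℕ} {u : BiPoly}
    (hu : appell u = -(n * (n + 5) : ℝ) • u) {k : ℕ} (hk : k ≤ n) {w : BiPoly} (hw : DegLT k w) :
    bubbleIntegral (u * w) = 0 := by
  induction k generalizing w with
  | zero =>
    have : w = 0 := by
      ext m
      simp [hw m (Nat.zero_le _)]
    simp [this]
  | succ k ih =>
    have h1 := ih (by omega) hw.appell_add
    have h2 := bubbleIntegral_appell_mul u w
    rw [hu, smul_mul_assoc, map_smul, smul_eq_mul] at h2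
    rw [mul_add, mul_smul_comm, map_add, map_smul, smul_eq_mul, ← h2] at h1
    have h3 : ((n * (n + 5) : ℝ) - k * (k + 5)) * bubbleIntegral (u * w) = 0 := by
      linarith
    refine (mul_eq_zero.1 h3).resolve_left (sub_ne_zero.2 (ne_of_gt ?_))
    have : (k : ℝ) < n := by exact_mod_cast hk
    have : (0 : ℝ) ≤ k := k.cast_nonneg
    nlinarith

lemma forall_bubbleIntegral_eq_zero_iff {n : ℕ} {u : BiPoly} (hu : DegLT (n + 1) u) :
    (∀ w, DegLT n w → bubbleIntegral (u * w) = 0) ↔ appell u = -(n * (n + 5) : ℝ) • u := by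
  refine ⟨fun h => ?_, fun h w => bubbleIntegral_mul_eq_zero_of_appell h le_rfl⟩
  set g := appell u + (n * (n + 5) : ℝ) • u with hg
  have hgd : DegLT n g := hu.appell_add
  have hLg : DegLT n (appell g) := by
    intro m hm
    have h0 : coeff (m + Finsupp.single 0 1) g = 0 := hgd _ (by simp; omega)
    have h1 : coeff (m + Finsupp.single 1 1) g = 0 := hgd _ (by simp; omega)
    rw [coeff_appell, h0, h1, hgd m hm]
    simp
  have hz : g = 0 := by
    apply eq_zero_of_bubbleIntegral_mul_self
    conv_lhs => rw [hg]
    rw [add_mul, map_add, bubbleIntegral_appell_mul, h _ hLg, smul_mul_assoc, map_smul, h _ hgd]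
    simp
  rw [neg_smul, eq_neg_iff_add_eq_zero, ← hg, hz]

lemma inPerp_unitTri_iff {n : ℕ} (hn : 1 ≤ n) {u : BiPoly} :
    inPerp n (0, 0) (1, 0) (0, 1) u ↔
      u.totalDegree ≤ n ∧ appell u = -(n * (n + 5) : ℝ) • u := by
  obtain ⟨k, rfl⟩ : ∃ k, n = k + 1 := ⟨n - 1, by omega⟩
  refine and_congr_right fun hu => ?_
  rw [← forall_bubbleIntegral_eq_zero_iff (degLT_succ_iff.2 hu)]
  simp [innerT_unitTri, degLT_succ_iff]

lemma totalDegree_bind₁_le {f : Fin 2 → BiPoly} (hf : ∀ i, (f i).totalDegree ≤ 1) (u : BiPoly) :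
    (bind₁ f u).totalDegree ≤ u.totalDegree := by
  conv_lhs => rw [u.as_sum, map_sum]
  refine totalDegree_finsetSum_le fun m hm => ?_
  rw [monomial_eq_smul, map_smul, map_mul, map_pow, map_pow, bind₁_X_right, bind₁_X_right]
  have hm : m 0 + m 1 ≤ u.totalDegree := by
    rw [← degree_eq_add]
    exact le_totalDegree hm
  have h (i : Fin 2) : (f i ^ m i).totalDegree ≤ m i :=
    (totalDegree_pow _ _).trans (mul_le_of_le_one_right (Nat.zero_le _) (hf i))
  exact (totalDegree_smul_le _ _).trans ((totalDegree_mul _ _).trans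
    ((add_le_add (h 0) (h 1)).trans hm))

lemma pderiv_bind₁ (f : Fin 2 → BiPoly) (i : Fin 2) (u : BiPoly) :
    pderiv i (bind₁ f u) =
      bind₁ f (pderiv 0 u) * pderiv i (f 0) + bind₁ f (pderiv 1 u) * pderiv i (f 1) := by
  induction u using MvPolynomial.induction_on with
  | C r => simp
  | add p q hp hq => simp only [map_add, hp, hq]; ring
  | mul_X p j hp =>
    simp only [map_mul, pderiv_mul, map_add, hp, bind₁_X_right]
    fin_cases j
    · simp [pderiv_X_of_ne (show (0 : Fin 2) ≠ 1 by decide)]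
      ring
    · simp [pderiv_X_of_ne (show (1 : Fin 2) ≠ 0 by decide)]
      ring

/-- Substitution of the linear map `(x, y) ↦ (x + a y, b y)`, which sends `T₁` to the triangle
with vertices `(0, 0)`, `(1, 0)`, `(a, b)`. -/
def shear (a b : ℝ) : BiPoly →ₐ[ℝ] BiPoly := bind₁ ![X 0 + C a * X 1, C b * X 1]

/-- The linear map `(x, y) ↦ (x + a y, b y)` of the plane. -/
def shearEquiv (a : ℝ) {b : ℝ} (hb : b ≠ 0) : (ℝ × ℝ) ≃L[ℝ] (ℝ × ℝ) :=
  LinearEquiv.toContinuousLinearEquiv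
    { toFun := fun p => (p.1 + a * p.2, b * p.2)
      invFun := fun p => (p.1 - a * (p.2 / b), p.2 / b)
      map_add' := fun p q => by ext <;> simp <;> ring
      map_smul' := fun r p => by ext <;> simp <;> ring
      left_inv := fun p => by ext <;> simp [hb]
      right_inv := fun p => by ext <;> simp; field_simp }

lemma shearEquiv_apply (a : ℝ) {b : ℝ} (hb : b ≠ 0) (p : ℝ × ℝ) :
    shearEquiv a hb p = (p.1 + a * p.2, b * p.2) := rfl

lemma image_shearEquiv (a : ℝ) {b : ℝ} (hb : b ≠ 0) :
    shearEquiv a hb '' unitTri = tri (1, 0) (0, 0) (a, b) := by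
  have h := (shearEquiv a hb).toHomeomorph.image_interior
    (convexHull ℝ {((0, 0) : ℝ × ℝ), (1, 0), (0, 1)})
  have h' := ((shearEquiv a hb).toLinearEquiv.toLinearMap).image_convexHull
    {((0, 0) : ℝ × ℝ), (1, 0), (0, 1)}
  refine h.trans ?_
  refine congrArg interior (h'.trans ?_)
  rw [Set.insert_comm (1, 0)]
  simp [Set.image_insert_eq, shearEquiv_apply]

lemma bubble_shearEquiv (a : ℝ) {b : ℝ} (hb : b ≠ 0) (p : ℝ × ℝ) :
    bubble (1, 0) (0, 0) (a, b) (shearEquiv a hb p) = unitBubble p := by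
  rw [unitBubble_apply, shearEquiv_apply]
  simp only [bubble, bary, det2, Prod.fst_sub, Prod.snd_sub]
  have h1 : (0 - 1) * (b - 0) - (0 - 0) * (a - 1) ≠ 0 := by simpa using hb
  field_simp
  ring_nf
  field_simp

lemma evalP_shearEquiv (a : ℝ) {b : ℝ} (hb : b ≠ 0) (u : BiPoly) (p : ℝ × ℝ) :
    evalP u (shearEquiv a hb p) = evalP (shear a b u) p := by
  simp only [evalP, shear, shearEquiv_apply]
  induction u using MvPolynomial.induction_on with
  | C r => simp
  | add p q hp hq => simp only [map_add, hp, hq]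
  | mul_X p j hp =>
    simp only [map_mul, hp, bind₁_X_right, eval_X]
    congr 1
    fin_cases j <;> simp

lemma innerT_shear_eq_zero_iff (a : ℝ) {b : ℝ} (hb : b ≠ 0) (u w : BiPoly) :
    innerT (1, 0) (0, 0) (a, b) u w = 0 ↔
      bubbleIntegral (shear a b u * shear a b w) = 0 := by
  have h := integral_image_eq_integral_abs_det_fderiv_smul volume
    (s := unitTri) isOpen_interior.measurableSet
    (fun p _ => (shearEquiv a hb).hasFDerivAt.hasFDerivWithinAt)
    (shearEquiv a hb).injective.injOn
    (fun p => evalP u p * evalP w p * bubble (1, 0) (0, 0) (a, b) p)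
  have hdet : ((shearEquiv a hb : (ℝ × ℝ) ≃L[ℝ] (ℝ × ℝ)) : (ℝ × ℝ) →L[ℝ] (ℝ × ℝ)).det ≠ 0 :=
    (LinearEquiv.isUnit_det' (shearEquiv a hb).toLinearEquiv).ne_zero
  rw [image_shearEquiv, integral_smul] at h
  rw [innerT, h, smul_eq_mul, mul_eq_zero, abs_eq_zero, or_iff_right hdet]
  simp only [evalP_shearEquiv, bubble_shearEquiv]
  simp [bubbleIntegral, evalP]

lemma shear_shear (a b a' b' : ℝ) (u : BiPoly) :
    shear a b (shear a' b' u) = shear (a + a' * b) (b * b') u := by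
  refine DFunLike.congr_fun (f := (shear a b).comp (shear a' b')) (MvPolynomial.algHom_ext fun i => ?_) u
  fin_cases i
  · simp [shear]
    ring
  · simp [shear]
    ring

lemma shear_zero_one (u : BiPoly) : shear 0 1 u = u := by
  refine DFunLike.congr_fun (g := AlgHom.id ℝ BiPoly) (MvPolynomial.algHom_ext fun i => ?_) u
  fin_cases i <;> simp [shear]

lemma shear_inv_shear (a : ℝ) {b : ℝ} (hb : b ≠ 0) (u : BiPoly) :
    shear (-a / b) b⁻¹ (shear a b u) = u := by
  rw [shear_shear, inv_mul_cancel₀ hb, show -a / b + a * b⁻¹ = 0 by ring, shear_zero_one]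

lemma shear_shear_inv (a : ℝ) {b : ℝ} (hb : b ≠ 0) (u : BiPoly) :
    shear a b (shear (-a / b) b⁻¹ u) = u := by
  rw [shear_shear, mul_inv_cancel₀ hb, show a + -a / b * b = 0 by field_simp; ring, shear_zero_one]

lemma totalDegree_shear_le (a b : ℝ) (u : BiPoly) :
    (shear a b u).totalDegree ≤ u.totalDegree := by
  have h (r : ℝ) (i : Fin 2) : (C r * X i : BiPoly).totalDegree ≤ 1 :=
    (totalDegree_mul _ _).trans (by simp)
  refine totalDegree_bind₁_le (fun i => ?_) u
  fin_cases i
  · exact (totalDegree_add _ _).trans (max_le (by simp) (h a 1))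
  · exact h b 1

lemma inPerp_shear_iff {n : ℕ} (a : ℝ) {b : ℝ} (hb : b ≠ 0) (u : BiPoly) :
    inPerp n (1, 0) (0, 0) (a, b) u ↔ inPerp n (0, 0) (1, 0) (0, 1) (shear a b u) := by
  refine and_congr ⟨(totalDegree_shear_le a b u).trans, fun h => ?_⟩ ⟨fun h w hw => ?_, fun h w hw => ?_⟩
  · rw [← shear_inv_shear a hb u]
    exact (totalDegree_shear_le _ _ _).trans h
  · rw [innerT_unitTri, ← shear_shear_inv a hb w, ← innerT_shear_eq_zero_iff a hb]
    exact h _ ((totalDegree_shear_le _ _ _).trans hw)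
  · rw [innerT_shear_eq_zero_iff a hb, ← innerT_unitTri]
    exact h _ ((totalDegree_shear_le _ _ _).trans hw)

/-- The difference between the pullback of Appell's operator to the triangle with vertices
`(0, 0)`, `(1, 0)`, `(a, b)` and Appell's operator of the unit triangle. -/
def appellDiff (a b : ℝ) (u : BiPoly) : BiPoly :=
  C ((a ^ 2 - a) / b) * X 1 * pderiv 0 (pderiv 0 u) + 2 * C a * X 1 * pderiv 0 (pderiv 1 u)
    + C (b - 1) * X 1 * pderiv 1 (pderiv 1 u) + 2 * C a * pderiv 0 u + 2 * C (b - 1) * pderiv 1 u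

lemma appell_shear (a : ℝ) {b : ℝ} (hb : b ≠ 0) (u : BiPoly) :
    appell (shear a b u) = shear a b (appell u + appellDiff a b u) := by
  have h0 (v : BiPoly) : pderiv 0 (shear a b v) = shear a b (pderiv 0 v) := by
    simp [shear, pderiv_bind₁]
  have h1 (v : BiPoly) : pderiv 1 (shear a b v) =
      C a * shear a b (pderiv 0 v) + C b * shear a b (pderiv 1 v) := by
    simp [shear, pderiv_bind₁]
    ring
  have hX0 : shear a b (X 0) = X 0 + C a * X 1 := by simp [shear]
  have hX1 : shear a b (X 1) = C b * X 1 := by simp [shear]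
  have hC (r : ℝ) : shear a b (C r) = C r := by simp [shear]
  have hab : (C ((a ^ 2 - a) / b) * C b : BiPoly) = C a ^ 2 - C a := by
    rw [← C_mul, div_mul_cancel₀ _ hb, C_sub, C_pow]
  simp only [appell, appellDiff, h0, h1, map_add, map_sub, map_mul, hX0, hX1, hC, map_ofNat,
    map_one, pderiv_C_mul, pderiv_comm]
  linear_combination (-(X 1 * shear a b (pderiv 0 (pderiv 0 u)))) * hab

lemma inPerp_inter_iff {n : ℕ} (hn : 1 ≤ n) (a : ℝ) {b : ℝ} (hb : b ≠ 0) (u : BiPoly) :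
    (inPerp n (0, 0) (1, 0) (0, 1) u ∧ inPerp n (1, 0) (0, 0) (a, b) u) ↔
      u.totalDegree ≤ n ∧ appell u = -(n * (n + 5) : ℝ) • u ∧ appellDiff a b u = 0 := by
  rw [inPerp_shear_iff a hb, inPerp_unitTri_iff hn, inPerp_unitTri_iff hn, appell_shear a hb,
    ← map_smul, (Function.LeftInverse.injective (shear_inv_shear a hb)).eq_iff]
  constructor
  · rintro ⟨⟨h1, h2⟩, -, h3⟩
    exact ⟨h1, h2, by rwa [h2, add_eq_left] at h3⟩
  · rintro ⟨h1, h2, h3⟩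
    exact ⟨⟨h1, h2⟩, (totalDegree_shear_le _ _ _).trans h1, by rw [h2, h3, add_zero]⟩

lemma eq_zero_of_pderiv_eq {v : BiPoly} {r s : ℝ} (hr : 0 < r)
    (h : X 1 * pderiv 1 v + C r * v = C s * (X 1 * pderiv 0 v)) : v = 0 := by
  have key : ∀ (k : ℕ) (m : Fin 2 →₀ ℕ), m 1 = k → coeff m v = 0 := by
    intro k
    induction k with
    | zero =>
      intro m hm
      have := congrArg (coeff m) h
      have hm' : 1 ∉ m.support := by simpa using hm
      rw [coeff_add, coeff_X_mul_pderiv, coeff_C_mul, coeff_C_mul, coeff_X_mul', if_neg hm', hm]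
        at this
      simpa [hr.ne'] using this
    | succ k ih =>
      intro m hm
      have := congrArg (coeff m) h
      have hm' : 1 ∈ m.support := by simp [hm]
      rw [coeff_add, coeff_X_mul_pderiv, coeff_C_mul, coeff_C_mul, coeff_X_mul', if_pos hm',
        coeff_pderiv, ih (m - Finsupp.single 1 1 + Finsupp.single 0 1) (by simp [hm]), ← add_mul,
        zero_mul, mul_zero] at this
      exact (mul_eq_zero.1 this).resolve_left (by positivity)
  ext m
  simpa using key _ m rfl

lemma mem_range_aeval_X_of_pderiv_eq_zero {i j : Fin 2} (hij : i ≠ j) {u : BiPoly}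
    (h : pderiv i u = 0) : u ∈ (Polynomial.aeval (X j : BiPoly) : ℝ[X] →ₐ[ℝ] BiPoly).range := by
  refine ⟨∑ m ∈ u.support, Polynomial.monomial (m j) (coeff m u), ?_⟩
  conv_rhs => rw [u.as_sum]
  simp only [AlgHom.toRingHom_eq_coe, RingHom.coe_coe, map_sum]
  refine Finset.sum_congr rfl fun m hm => ?_
  have hi : m i = 0 := by
    have := coeff_X_mul_pderiv i u m
    rw [h, mul_zero, coeff_zero, zero_eq_mul] at this
    exact_mod_cast this.resolve_right (mem_support_iff.1 hm)
  rw [Polynomial.aeval_monomial, monomial_eq_smul, algebraMap_eq, smul_eq_C_mul]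
  congr 1
  fin_cases i <;> fin_cases j <;> simp_all

lemma appellDiff_zero_eq_zero_iff {b : ℝ} (hb : b ≠ 1) (u : BiPoly) :
    appellDiff 0 b u = 0 ↔ u ∈ (Polynomial.aeval (X 0 : BiPoly) : ℝ[X] →ₐ[ℝ] BiPoly).range := by
  constructor
  · intro h
    refine mem_range_aeval_X_of_pderiv_eq_zero (i := 1) (by decide)
      (eq_zero_of_pderiv_eq (r := 2) (s := 0) (by norm_num) ?_)
    have hc : (C (b - 1) : BiPoly) ≠ 0 := C_ne_zero.2 (sub_ne_zero.2 hb)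
    refine mul_left_cancel₀ hc ?_
    simp [appellDiff] at h
    simp only [map_ofNat, map_zero, C_sub, C_1]
    linear_combination h
  · rintro ⟨f, rfl⟩
    simp [appellDiff]

lemma appellDiff_one_eq_zero_iff {a : ℝ} (ha : a ≠ 0) (u : BiPoly) :
    appellDiff a 1 u = 0 ↔ u ∈ (Polynomial.aeval (X 1 : BiPoly) : ℝ[X] →ₐ[ℝ] BiPoly).range := by
  constructor
  · intro h
    refine mem_range_aeval_X_of_pderiv_eq_zero (i := 0) (by decide)
      (eq_zero_of_pderiv_eq (r := 1) (s := (1 - a) / 2) (by norm_num) ?_)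
    have hc : (C (2 * a) : BiPoly) ≠ 0 := by simpa using ha
    refine mul_left_cancel₀ hc ?_
    have h2 : (C (2 * a) * C ((1 - a) / 2) : BiPoly) = C a - C a ^ 2 := by
      rw [← C_pow, ← C_sub, ← C_mul]
      congr 1
      ring
    simp [appellDiff] at h
    simp only [C_1, pderiv_comm, C_mul, map_ofNat] at h2 ⊢
    linear_combination h - X 1 * pderiv 0 (pderiv 0 u) * h2
  · rintro ⟨f, rfl⟩
    simp [appellDiff]

/-- The reflection `(x, y) ↦ (1 - x - y, y)` of the unit triangle. -/
def reflect : BiPoly →ₐ[ℝ] BiPoly := bind₁ ![1 - X 0 - X 1, X 1]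

lemma reflect_reflect (u : BiPoly) : reflect (reflect u) = u := by
  refine DFunLike.congr_fun (f := reflect.comp reflect) (g := AlgHom.id ℝ BiPoly)
    (MvPolynomial.algHom_ext fun i => ?_) u
  fin_cases i
  · simp [reflect]
    ring
  · simp [reflect]

lemma appellDiff_one_sub_eq_zero_iff {b : ℝ} (hb : b ≠ 0) (hb1 : b ≠ 1) (u : BiPoly) :
    appellDiff (1 - b) b u = 0 ↔
      u ∈ (Polynomial.aeval (1 - X 0 - X 1 : BiPoly) : ℝ[X] →ₐ[ℝ] BiPoly).range := by
  have hab : ((1 - b) ^ 2 - (1 - b)) / b = b - 1 := by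
    field_simp
    ring
  constructor
  · intro h
    have h0 : pderiv 1 u - pderiv 0 u = 0 := by
      refine eq_zero_of_pderiv_eq (r := 2) (s := 1) (by norm_num) ?_
      have hc : (C (b - 1) : BiPoly) ≠ 0 := C_ne_zero.2 (sub_ne_zero.2 hb1)
      refine mul_left_cancel₀ hc ?_
      rw [appellDiff, hab] at h
      simp only [map_ofNat, map_sub, C_1, pderiv_comm] at h ⊢
      linear_combination h
    have h1 : pderiv 1 (reflect u) = 0 := by
      have := congrArg reflect h0
      rw [map_sub, map_zero] at this
      simpa [reflect, pderiv_bind₁, neg_add_eq_sub] using this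
    obtain ⟨f, hf⟩ := mem_range_aeval_X_of_pderiv_eq_zero (i := 1) (j := 0) (by decide) h1
    refine ⟨f, ?_⟩
    rw [← reflect_reflect u, ← hf]
    simp only [AlgHom.toRingHom_eq_coe, RingHom.coe_coe]
    rw [← Polynomial.aeval_algHom_apply]
    simp [reflect]
  · rintro ⟨f, rfl⟩
    rw [appellDiff, hab]
    simp
    ring

/-- The univariate Jacobi operator with weight `x (1 - x)³` on `[0, 1]`. -/
def jacobiOp (f : ℝ[X]) : ℝ[X] :=
  Polynomial.X * (1 - Polynomial.X) * Polynomial.derivative (Polynomial.derivative f)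
    + (2 - 6 * Polynomial.X) * Polynomial.derivative f

lemma coeff_jacobiOp (f : ℝ[X]) (k : ℕ) :
    (jacobiOp f).coeff k = (k + 1) * (k + 2) * f.coeff (k + 1) - k * (k + 5) * f.coeff k := by
  have h : jacobiOp f = Polynomial.X * Polynomial.derivative (Polynomial.derivative f)
      + Polynomial.C 2 * Polynomial.derivative f
      - Polynomial.X * Polynomial.derivative (Polynomial.X * Polynomial.derivative f)
      - Polynomial.C 5 * (Polynomial.X * Polynomial.derivative f) := by
    simp only [jacobiOp, Polynomial.derivative_mul, Polynomial.derivative_X, map_ofNat]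
    ring
  have hX (g : ℝ[X]) : (Polynomial.X * Polynomial.derivative g).coeff k = k * g.coeff k := by
    cases k with
    | zero => simp
    | succ k =>
      rw [Polynomial.coeff_X_mul, Polynomial.coeff_derivative]
      push_cast
      ring
  rw [h]
  simp only [Polynomial.coeff_sub, Polynomial.coeff_add, Polynomial.coeff_C_mul, hX,
    Polynomial.coeff_derivative]
  ring

lemma jacobiOp_eq_iff (n : ℕ) (f : ℝ[X]) :
    jacobiOp f = -(n * (n + 5) : ℝ) • f ↔
      ∀ k : ℕ, (k + 1) * (k + 2) * f.coeff (k + 1) = (k - n) * (k + n + 5) * f.coeff k := by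
  rw [Polynomial.ext_iff]
  refine forall_congr' fun k => ?_
  rw [coeff_jacobiOp, Polynomial.coeff_smul, smul_eq_mul]
  constructor <;> intro h <;> linear_combination h

lemma eq_smul_of_jacobiOp_eq {n : ℕ} {f g : ℝ[X]} (hf : jacobiOp f = -(n * (n + 5) : ℝ) • f)
    (hg : jacobiOp g = -(n * (n + 5) : ℝ) • g) (hg0 : g.coeff 0 ≠ 0) :
    f = (f.coeff 0 / g.coeff 0) • g := by
  rw [jacobiOp_eq_iff] at hf hg
  ext k
  rw [Polynomial.coeff_smul, smul_eq_mul]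
  induction k with
  | zero => field_simp
  | succ k ih =>
    have hk : ((k : ℝ) + 1) * (k + 2) ≠ 0 := by positivity
    refine mul_left_cancel₀ hk ?_
    rw [hf, ih]
    linear_combination (-(f.coeff 0 / g.coeff 0)) * hg k

/-- The Jacobi polynomial in the variable `(1 - x) / 2`. -/
def shiftedJacobi (n : ℕ) (a b : ℝ) : ℝ[X] :=
  Polynomial.C (poch (a + 1) n / (n.factorial : ℝ)) *
    ∑ k ∈ Finset.range (n + 1),
      Polynomial.C (poch (-(n : ℝ)) k * poch ((n : ℝ) + a + b + 1) k /
          (poch (a + 1) k * (k.factorial : ℝ))) * Polynomial.X ^ k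

lemma substX_jacobiPoly (n : ℕ) (a b : ℝ) (l : BiPoly) :
    substX (jacobiPoly n a b) (1 - 2 * l) = Polynomial.aeval l (shiftedJacobi n a b) := by
  have h : (Polynomial.aeval (1 - 2 * l)) (Polynomial.C (2⁻¹ : ℝ) * (1 - Polynomial.X)) = l := by
    have h2 : (C (2⁻¹ : ℝ) * 2 : BiPoly) = 1 := by
      rw [← map_ofNat (C : ℝ →+* BiPoly) 2, ← C_mul]
      norm_num
    simp only [map_mul, map_sub, map_one, Polynomial.aeval_C, Polynomial.aeval_X, algebraMap_eq]
    linear_combination l * h2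
  rw [substX, jacobiPoly, shiftedJacobi, map_mul, map_mul, map_sum, map_sum]
  congr 1
  · simp
  · refine Finset.sum_congr rfl fun k _ => ?_
    rw [map_mul, map_mul, map_pow, map_pow, h, Polynomial.aeval_C, Polynomial.aeval_C,
      Polynomial.aeval_X]

lemma poch_succ (a : ℝ) (k : ℕ) : poch a (k + 1) = poch a k * (a + k) :=
  Finset.prod_range_succ _ _

lemma poch_pos {a : ℝ} (ha : 0 < a) (k : ℕ) : 0 < poch a k :=
  Finset.prod_pos fun _ _ => by positivity

lemma poch_neg_eq_zero {n k : ℕ} (h : n < k) : poch (-(n : ℝ)) k = 0 :=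
  Finset.prod_eq_zero (Finset.mem_range.2 h) (by simp)

lemma coeff_shiftedJacobi (n : ℕ) (a b : ℝ) (k : ℕ) :
    (shiftedJacobi n a b).coeff k = poch (a + 1) n / (n.factorial : ℝ) *
      (poch (-(n : ℝ)) k * poch ((n : ℝ) + a + b + 1) k / (poch (a + 1) k * (k.factorial : ℝ))) := by
  simp only [shiftedJacobi, Polynomial.coeff_C_mul, Polynomial.finsetSum_coeff,
    Polynomial.coeff_X_pow, mul_ite, mul_one, mul_zero, Finset.sum_ite_eq, Finset.mem_range]
  split_ifs with h
  · rfl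
  · rw [poch_neg_eq_zero (by omega)]
    simp

lemma natDegree_shiftedJacobi_le (n : ℕ) (a b : ℝ) : (shiftedJacobi n a b).natDegree ≤ n := by
  refine Polynomial.natDegree_le_iff_coeff_eq_zero.2 fun k hk => ?_
  rw [coeff_shiftedJacobi, poch_neg_eq_zero hk]
  simp

lemma jacobiOp_shiftedJacobi (n : ℕ) :
    jacobiOp (shiftedJacobi n 1 3) = -(n * (n + 5) : ℝ) • shiftedJacobi n 1 3 := by
  rw [jacobiOp_eq_iff]
  intro k
  have h2 := (poch_pos (show (0 : ℝ) < 1 + 1 by norm_num) k).ne'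
  rw [coeff_shiftedJacobi, coeff_shiftedJacobi, poch_succ, poch_succ, poch_succ,
    Nat.factorial_succ]
  have h3 : (1 + 1 + k : ℝ) ≠ 0 := by positivity
  push_cast
  field_simp
  ring

lemma coeff_zero_shiftedJacobi_ne_zero (n : ℕ) : (shiftedJacobi n 1 3).coeff 0 ≠ 0 := by
  have h := poch_pos (show (0 : ℝ) < 1 + 1 by norm_num) n
  have h0 (a : ℝ) : poch a 0 = 1 := Finset.prod_range_zero _
  rw [coeff_shiftedJacobi, h0, h0, h0]
  simp only [Nat.factorial_zero, Nat.cast_one, mul_one, div_one]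
  positivity

lemma totalDegree_polynomial_aeval_le {l : BiPoly} (hl : l.totalDegree ≤ 1) (f : ℝ[X]) :
    (Polynomial.aeval l f).totalDegree ≤ f.natDegree := by
  rw [Polynomial.aeval_eq_sum_range]
  refine totalDegree_finsetSum_le fun k hk => (totalDegree_smul_le _ _).trans
    ((totalDegree_pow _ _).trans ((mul_le_of_le_one_right (Nat.zero_le _) hl).trans ?_))
  exact Nat.lt_succ_iff.1 (Finset.mem_range.1 hk)

lemma appell_polynomial_aeval {l : BiPoly}
    (hl : l = X 0 ∨ l = 1 - X 0 - X 1 ∨ l = X 1) (f : ℝ[X]) :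
    appell (Polynomial.aeval l f) = Polynomial.aeval l (jacobiOp f) := by
  have h : Polynomial.aeval l (jacobiOp f) =
      l * (1 - l) * Polynomial.aeval l (Polynomial.derivative (Polynomial.derivative f))
        + (2 - 6 * l) * Polynomial.aeval l (Polynomial.derivative f) := by
    simp only [jacobiOp, map_add, map_sub, map_mul, map_one, map_ofNat, Polynomial.aeval_X]
  rw [h]
  rcases hl with rfl | rfl | rfl <;> simp [appell]
  ring

lemma inPerp_inter_iff_of_range {n : ℕ} (hn : 1 ≤ n) (a : ℝ) {b : ℝ} (hb : b ≠ 0) {l : BiPoly}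
    (hl : l = X 0 ∨ l = 1 - X 0 - X 1 ∨ l = X 1)
    (hD : ∀ u, appellDiff a b u = 0 ↔
      u ∈ (Polynomial.aeval l : ℝ[X] →ₐ[ℝ] BiPoly).range) :
    substX (jacobiPoly n 1 3) (1 - 2 * l) ≠ 0 ∧
      ∀ u, (inPerp n (0, 0) (1, 0) (0, 1) u ∧ inPerp n (1, 0) (0, 0) (a, b) u) ↔
        ∃ t : ℝ, u = t • substX (jacobiPoly n 1 3) (1 - 2 * l) := by
  have hdeg : l.totalDegree ≤ 1 := by
    rcases hl with rfl | rfl | rfl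
    · simp
    · refine (totalDegree_sub _ _).trans (max_le ((totalDegree_sub _ _).trans ?_) ?_) <;> simp
    · simp
  obtain ⟨g, hg⟩ : ∃ g : BiPoly →ₐ[ℝ] ℝ[X], g l = Polynomial.X := by
    rcases hl with rfl | rfl | rfl
    · exact ⟨aeval ![Polynomial.X, 0], by simp⟩
    · exact ⟨aeval ![1 - Polynomial.X, 0], by simp⟩
    · exact ⟨aeval ![0, Polynomial.X], by simp⟩
  have hinj : Function.Injective (Polynomial.aeval l : ℝ[X] →ₐ[ℝ] BiPoly) := by
    refine Function.LeftInverse.injective (g := g) fun f => ?_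
    rw [← Polynomial.aeval_algHom_apply, hg, Polynomial.aeval_X_left_apply]
  have h0 := coeff_zero_shiftedJacobi_ne_zero n
  rw [substX_jacobiPoly]
  refine ⟨fun h => h0 ?_, fun u => ?_⟩
  · rw [hinj (h.trans (map_zero _).symm), Polynomial.coeff_zero]
  rw [inPerp_inter_iff hn a hb]
  constructor
  · rintro ⟨-, h1, h2⟩
    obtain ⟨f, rfl⟩ := (hD u).1 h2
    simp only [AlgHom.toRingHom_eq_coe, RingHom.coe_coe] at h1 ⊢
    rw [appell_polynomial_aeval hl, ← map_smul] at h1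
    refine ⟨f.coeff 0 / (shiftedJacobi n 1 3).coeff 0, ?_⟩
    conv_lhs => rw [eq_smul_of_jacobiOp_eq (hinj h1) (jacobiOp_shiftedJacobi n) h0]
    rw [map_smul]
  · rintro ⟨t, rfl⟩
    refine ⟨(totalDegree_smul_le _ _).trans ((totalDegree_polynomial_aeval_le hdeg _).trans
      (natDegree_shiftedJacobi_le n 1 3)), ?_,
      (hD _).2 (Subalgebra.smul_mem _ (AlgHom.mem_range_self _ _) t)⟩
    have hs : jacobiOp (t • shiftedJacobi n 1 3) = t • jacobiOp (shiftedJacobi n 1 3) := by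
      simp [jacobiOp, smul_add]
    rw [← map_smul, appell_polynomial_aeval hl, hs, jacobiOp_shiftedJacobi, ← map_smul, smul_comm]

/-- Let `n ≥ 1`, `c ≠ d`, `(c,d) ≠ (0,1)`.
(i) If `c = 0` then `P_{n-1}^⊥(T₁) ∩ P_{n-1}^⊥(K_{c,d})` is one-dimensional, spanned by
`(x,y) ↦ P_n^{(1,3)}(1-2x)`.
(ii) If `d = 1` it is one-dimensional, spanned by `(x,y) ↦ P_n^{(1,3)}(2(x+y)-1)`.
(iii) If `d = c+1` it is one-dimensional, spanned by `(x,y) ↦ P_n^{(1,3)}(1-2y)`. -/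
theorem statement4 (n : ℕ) (hn : 1 ≤ n) (c d : ℝ) (hcd : c ≠ d) (h01 : ¬(c = 0 ∧ d = 1)) :
    (c = 0 →
      substX (jacobiPoly n 1 3) (1 - 2 * MvPolynomial.X 0) ≠ 0 ∧
      ∀ u : MvPolynomial (Fin 2) ℝ,
        (inPerp n (0, 0) (1, 0) (0, 1) u ∧
            inPerp n (1, 0) (0, 0) (-c / (d - c), 1 / (d - c)) u) ↔
          ∃ t : ℝ, u = t • substX (jacobiPoly n 1 3) (1 - 2 * MvPolynomial.X 0)) ∧
    (d = 1 →
      substX (jacobiPoly n 1 3) (2 * (MvPolynomial.X 0 + MvPolynomial.X 1) - 1) ≠ 0 ∧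
      ∀ u : MvPolynomial (Fin 2) ℝ,
        (inPerp n (0, 0) (1, 0) (0, 1) u ∧
            inPerp n (1, 0) (0, 0) (-c / (d - c), 1 / (d - c)) u) ↔
          ∃ t : ℝ, u = t • substX (jacobiPoly n 1 3)
            (2 * (MvPolynomial.X 0 + MvPolynomial.X 1) - 1)) ∧
    (d = c + 1 →
      substX (jacobiPoly n 1 3) (1 - 2 * MvPolynomial.X 1) ≠ 0 ∧
      ∀ u : MvPolynomial (Fin 2) ℝ,
        (inPerp n (0, 0) (1, 0) (0, 1) u ∧
            inPerp n (1, 0) (0, 0) (-c / (d - c), 1 / (d - c)) u) ↔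
          ∃ t : ℝ, u = t • substX (jacobiPoly n 1 3) (1 - 2 * MvPolynomial.X 1)) := by
  have hdc : d - c ≠ 0 := sub_ne_zero.2 hcd.symm
  have hb : 1 / (d - c) ≠ 0 := one_div_ne_zero hdc
  refine ⟨fun hc => ?_, fun hd => ?_, fun hd => ?_⟩
  · subst hc
    have hd : 1 / (d - 0) ≠ 1 := fun h => h01 ⟨rfl, by simpa using h⟩
    refine inPerp_inter_iff_of_range hn _ hb (.inl rfl) fun u => ?_
    rw [neg_zero, zero_div]
    exact appellDiff_zero_eq_zero_iff hd u
  · subst hd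
    have hc : 1 / (1 - c) ≠ 1 := by
      intro h
      rw [div_eq_one_iff_eq hdc] at h
      exact h01 ⟨by linarith, rfl⟩
    rw [show (2 * (MvPolynomial.X 0 + MvPolynomial.X 1) - 1 : BiPoly)
      = 1 - 2 * (1 - MvPolynomial.X 0 - MvPolynomial.X 1) by ring]
    refine inPerp_inter_iff_of_range hn _ hb (.inr (.inl rfl)) fun u => ?_
    rw [show -c / (1 - c) = 1 - 1 / (1 - c) by field_simp; ring]
    exact appellDiff_one_sub_eq_zero_iff hb hc u
  · subst hd
    have hc : c ≠ 0 := fun h => h01 ⟨h, by simp [h]⟩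
    refine inPerp_inter_iff_of_range hn _ hb (.inr (.inr rfl)) fun u => ?_
    rw [add_sub_cancel_left, div_one, div_one]
    exact appellDiff_one_eq_zero_iff (neg_ne_zero.2 hc) u
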